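/- Let t, n ∈ ℕ with n > t and let x ∈ I_t \ I_{t+1}. Then K_{M_n}(x) = 0 if x − x_t e_t ∉ I_n, and K_{M_n}(x) = M_t / (1 − r_t(x)) if x − x_t e_t ∈ I_n. -/

import Mathlib

open MeasureTheory Filter
open scoped ENNReal NNReal Real BigOperators

noncomputable section

namespace Vilenkin

instance (k : ℕ) : MeasurableSpace (ZMod k) := ⊤

/-- The Vilenkin group: the product of the cyclic groups `ZMod (m n)`. -/
abbrev G (m : ℕ → ℕ) : Type := ∀ n : ℕ, ZMod (m n)

variable (m : ℕ → ℕ)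

/-- The generalized powers `M_0 = 1`, `M_{n+1} = m_n M_n`. -/
def Mprod : ℕ → ℕ
  | 0 => 1
  | n + 1 => m n * Mprod n

/-- The `k`-th digit of `n` in the base-`M` expansion `n = Σ_k n_k M_k`. -/
def digit (n k : ℕ) : ℕ := (n / Mprod m k) % m k

/-- `⟨n⟩`, the smallest index of a nonzero digit. -/
def lowIdx (n : ℕ) : ℕ := sInf {j | digit m n j ≠ 0}

/-- `|n|`, the largest index of a nonzero digit. -/
def highIdx (n : ℕ) : ℕ := sSup {j | digit m n j ≠ 0}

/-- Generalized Rademacher functions `r_k(x) = exp(2πi x_k / m_k)`. -/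
def rad (k : ℕ) (x : G m) : ℂ :=
  Complex.exp (2 * Real.pi * Complex.I * ((x k).val : ℂ) / (m k : ℂ))

/-- The Vilenkin system `ψ_n = ∏_k r_k^{n_k}`. -/
def psi (n : ℕ) (x : G m) : ℂ :=
  ∏ k ∈ Finset.range (n + 1), rad m k x ^ digit m n k

/-- Dirichlet kernels `D_n = Σ_{k<n} ψ_k`. -/
def Dker (n : ℕ) (x : G m) : ℂ := ∑ k ∈ Finset.range n, psi m k x

/-- Fejér kernels `K_n = (1/n) Σ_{k<n} D_k`. -/
def Kker (n : ℕ) (x : G m) : ℂ := (n : ℂ)⁻¹ * ∑ k ∈ Finset.range n, Dker m k x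

/-- The cylinder `I_n(x)`. -/
def cylinder (n : ℕ) (x : G m) : Set (G m) := {y | ∀ j, j < n → y j = x j}

/-- `e_t`: the element with `t`-th coordinate `1` and all others `0`. -/
def eVec (t : ℕ) : G m := fun j => if j = t then 1 else 0

/-- The filtration `F_n` generated by the cylinders of level `n`. -/
def filtr (n : ℕ) : MeasurableSpace (G m) :=
  MeasurableSpace.comap (fun x (j : Fin n) => x j.val) inferInstance

/-- The normalized Haar measure on `G_m`: the probability measure giving each cylinder
`I_n(x)` measure `1/M_n`. -/
def IsVilenkinMeasure (μ : Measure (G m)) : Prop :=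
  IsProbabilityMeasure μ ∧ ∀ n x, μ (cylinder m n x) = (Mprod m n : ℝ≥0∞)⁻¹

/-- Martingales with respect to the filtration `(F_n)`. -/
def IsMartingale (μ : Measure (G m)) (f : ℕ → G m → ℂ) : Prop :=
  (∀ n, Integrable (f n) μ) ∧
  (∀ n, Measurable[filtr m n] (f n)) ∧
  (∀ n, ∀ s : Set (G m), MeasurableSet[filtr m n] s →
    ∫ x in s, f (n + 1) x ∂μ = ∫ x in s, f n x ∂μ)

/-- The maximal function `f* = sup_n |f^{(n)}|` (with values in `ℝ≥0∞`). -/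
def maximalFn (f : ℕ → G m → ℂ) (x : G m) : ℝ≥0∞ := ⨆ n, (‖f n x‖₊ : ℝ≥0∞)

/-- The martingale Hardy space quasi-norm `‖f‖_{H_p} = ‖f*‖_{L_p}`. -/
def hardyNorm (p : ℝ) (μ : Measure (G m)) (f : ℕ → G m → ℂ) : ℝ≥0∞ :=
  (∫⁻ x, maximalFn m f x ^ p ∂μ) ^ (1 / p)

/-- Vilenkin-Fourier coefficients of an integrable function. -/
def fourierCoeff (μ : Measure (G m)) (g : G m → ℂ) (k : ℕ) : ℂ :=
  ∫ x, g x * (starRingEnd ℂ) (psi m k x) ∂μ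

/-- Partial sums `S_n g` of the Vilenkin-Fourier series of a function. -/
def SFun (μ : Measure (G m)) (g : G m → ℂ) (n : ℕ) (x : G m) : ℂ :=
  ∑ k ∈ Finset.range n, fourierCoeff m μ g k * psi m k x

/-- Fejér means `σ_n g` of a function. -/
def sigmaFun (μ : Measure (G m)) (g : G m → ℂ) (n : ℕ) (x : G m) : ℂ :=
  (n : ℂ)⁻¹ * ∑ k ∈ Finset.range n, SFun m μ g k x

/-- Vilenkin-Fourier coefficients of a martingale:
`f̂(i) = lim_k ∫ f^{(k)} ψ̄_i dμ`. -/
def martCoeff (μ : Measure (G m)) (f : ℕ → G m → ℂ) (i : ℕ) : ℂ :=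
  limUnder atTop fun k => ∫ x, f k x * (starRingEnd ℂ) (psi m i x) ∂μ

/-- Partial sums `S_n f` of the Vilenkin-Fourier series of a martingale. -/
def SMart (μ : Measure (G m)) (f : ℕ → G m → ℂ) (n : ℕ) (x : G m) : ℂ :=
  ∑ k ∈ Finset.range n, martCoeff m μ f k * psi m k x

/-- Fejér means `σ_n f` of a martingale. -/
def sigmaMart (μ : Measure (G m)) (f : ℕ → G m → ℂ) (n : ℕ) (x : G m) : ℂ :=
  (n : ℂ)⁻¹ * ∑ k ∈ Finset.range n, SMart m μ f k x

/-- The weak `L_p` quasi-norm `‖g‖_{L_{p,∞}} = (sup_λ λ^p μ(|g|>λ))^{1/p}`. -/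
def weakNorm (p : ℝ) (μ : Measure (G m)) (g : G m → ℂ) : ℝ≥0∞ :=
  (⨆ lam : ℝ≥0, (lam : ℝ≥0∞) ^ p * μ {x | (lam : ℝ) < ‖g x‖}) ^ (1 / p)

/-- A `p`-atom with prescribed support interval `I_N(x₀)`. -/
def IsPAtomAt (p : ℝ) (μ : Measure (G m)) (N : ℕ) (x₀ : G m) (a : G m → ℂ) : Prop :=
  Measurable a ∧ Function.support a ⊆ cylinder m N x₀ ∧
    (∫ x in cylinder m N x₀, a x ∂μ) = 0 ∧
    eLpNorm a ⊤ μ ≤ μ (cylinder m N x₀) ^ (-(1 / p))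

/-- A `p`-atom. -/
def IsPAtom (p : ℝ) (μ : Measure (G m)) (a : G m → ℂ) : Prop :=
  ∃ N x₀, IsPAtomAt m p μ N x₀ a

/-- The sets `I_N^{i,j}` for `i < j ≤ N`. -/
def IsetIJ (N i j : ℕ) : Set (G m) :=
  if j < N then
    {x | (∀ l, l < i → x l = 0) ∧ x i ≠ 0 ∧ (∀ l, i < l → l < j → x l = 0) ∧ x j ≠ 0}
  else
    {x | (∀ l, l < i → x l = 0) ∧ x i ≠ 0 ∧ (∀ l, i < l → l < N → x l = 0)}

theorem Mprod_pos {m : ℕ → ℕ} (hm : ∀ n, 2 ≤ m n) (n : ℕ) : 0 < Mprod m n := by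
  induction n with
  | zero => simp [Mprod]
  | succ n ih => exact Nat.mul_pos (by linarith [hm n]) ih

theorem lt_Mprod {m : ℕ → ℕ} (hm : ∀ n, 2 ≤ m n) (n : ℕ) : n < Mprod m n := by
  induction n with
  | zero => simp [Mprod]
  | succ n ih =>
    have := Nat.mul_le_mul_right (Mprod m n) (hm n)
    simp only [Mprod]
    omega

theorem Mprod_dvd (m : ℕ → ℕ) {i j : ℕ} (h : i ≤ j) : Mprod m i ∣ Mprod m j := by
  induction j, h using Nat.le_induction with
  | base => rfl
  | succ j _ ih => exact ih.mul_left _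

theorem digit_eq_zero {m : ℕ → ℕ} (hm : ∀ n, 2 ≤ m n) {n N k : ℕ} (h : n < Mprod m N)
    (hk : N ≤ k) : digit m n k = 0 := by
  have : n < Mprod m k :=
    h.trans_le (Nat.le_of_dvd (Mprod_pos hm k) (Mprod_dvd m hk))
  simp [digit, Nat.div_eq_of_lt this]

theorem psi_eq_prod_range {m : ℕ → ℕ} (hm : ∀ n, 2 ≤ m n) {n N : ℕ} (h : n < Mprod m N)
    (x : G m) : psi m n x = ∏ k ∈ Finset.range N, rad m k x ^ digit m n k := by
  have key : ∀ {A B : ℕ}, A ≤ B → n < Mprod m A →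
      ∏ k ∈ Finset.range A, rad m k x ^ digit m n k =
        ∏ k ∈ Finset.range B, rad m k x ^ digit m n k := by
    intro A B hAB hA
    refine Finset.prod_subset (Finset.range_mono hAB) fun k _ hk => ?_
    rw [digit_eq_zero hm hA (by simpa using hk), pow_zero]
  have hn : n < Mprod m (n + 1) := (Nat.lt_succ_self n).trans (lt_Mprod hm (n + 1))
  rw [psi, key (le_max_left (n + 1) N) hn, key (le_max_right (n + 1) N) h]

theorem digit_mul_add_of_lt {m : ℕ → ℕ} (hm : ∀ n, 2 ≤ m n) {k n : ℕ} (hk : k < n) (a b : ℕ) :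
    digit m (a * Mprod m n + b) k = digit m b k := by
  obtain ⟨c, hc⟩ := Mprod_dvd m (Nat.succ_le_of_lt hk)
  have h : a * Mprod m n + b = b + Mprod m k * (m k * (a * c)) := by
    rw [hc, Nat.succ_eq_add_one, Mprod]
    ring
  rw [digit, digit, h, Nat.add_mul_div_left _ _ (Mprod_pos hm k), Nat.add_mul_mod_self_left]

theorem digit_mul_add_self {m : ℕ → ℕ} {n a b : ℕ} (ha : a < m n)
    (hb : b < Mprod m n) : digit m (a * Mprod m n + b) n = a := by
  rw [digit, mul_comm, Nat.mul_add_div (by omega), Nat.div_eq_of_lt hb, add_zero,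
    Nat.mod_eq_of_lt ha]

theorem psi_mul_add {m : ℕ → ℕ} (hm : ∀ n, 2 ≤ m n) {n a b : ℕ} (ha : a < m n)
    (hb : b < Mprod m n) (x : G m) :
    psi m (a * Mprod m n + b) x = rad m n x ^ a * psi m b x := by
  have h : a * Mprod m n + b < Mprod m (n + 1) := by
    have := Nat.mul_le_mul_right (Mprod m n) (Nat.succ_le_of_lt ha)
    rw [Nat.succ_mul] at this
    simp only [Mprod]
    omega
  rw [psi_eq_prod_range hm h, psi_eq_prod_range hm hb, Finset.prod_range_succ,
    digit_mul_add_self ha hb, mul_comm]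
  congr 1
  refine Finset.prod_congr rfl fun k hk => ?_
  rw [digit_mul_add_of_lt hm (Finset.mem_range.mp hk)]

theorem sum_range_mul_eq_sum_sum (f : ℕ → ℂ) (a M : ℕ) :
    ∑ k ∈ Finset.range (a * M), f k =
      ∑ i ∈ Finset.range a, ∑ b ∈ Finset.range M, f (i * M + b) := by
  induction a with
  | zero => simp
  | succ a ih => rw [Nat.succ_mul, Finset.sum_range_add, ih, Finset.sum_range_succ]

theorem Dker_mul_Mprod {m : ℕ → ℕ} (hm : ∀ n, 2 ≤ m n) {n a : ℕ} (ha : a ≤ m n) (x : G m) :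
    Dker m (a * Mprod m n) x =
      (∑ i ∈ Finset.range a, rad m n x ^ i) * Dker m (Mprod m n) x := by
  rw [Dker, sum_range_mul_eq_sum_sum, Finset.sum_mul]
  refine Finset.sum_congr rfl fun i hi => ?_
  rw [Dker, Finset.mul_sum]
  refine Finset.sum_congr rfl fun b hb => ?_
  exact psi_mul_add hm ((Finset.mem_range.mp hi).trans_le ha) (Finset.mem_range.mp hb) x

theorem Dker_mul_add {m : ℕ → ℕ} (hm : ∀ n, 2 ≤ m n) {n a b : ℕ} (ha : a < m n)
    (hb : b ≤ Mprod m n) (x : G m) :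
    Dker m (a * Mprod m n + b) x =
      (∑ i ∈ Finset.range a, rad m n x ^ i) * Dker m (Mprod m n) x +
        rad m n x ^ a * Dker m b x := by
  rw [← Dker_mul_Mprod hm ha.le, Dker, Finset.sum_range_add, Dker, Dker, Finset.mul_sum]
  congr 1
  refine Finset.sum_congr rfl fun i hi => ?_
  exact psi_mul_add hm ha ((Finset.mem_range.mp hi).trans_le hb) x

theorem sum_Dker_Mprod_succ {m : ℕ → ℕ} (hm : ∀ n, 2 ≤ m n) (n : ℕ) (x : G m) :
    ∑ k ∈ Finset.range (Mprod m (n + 1)), Dker m k x =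
      Mprod m n * Dker m (Mprod m n) x *
          ∑ a ∈ Finset.range (m n), ∑ i ∈ Finset.range a, rad m n x ^ i +
        (∑ a ∈ Finset.range (m n), rad m n x ^ a) *
          ∑ k ∈ Finset.range (Mprod m n), Dker m k x := by
  rw [Mprod, sum_range_mul_eq_sum_sum, Finset.sum_mul, Finset.mul_sum, ← Finset.sum_add_distrib]
  refine Finset.sum_congr rfl fun a ha => ?_
  rw [Finset.sum_congr rfl fun b hb => Dker_mul_add hm (Finset.mem_range.mp ha)
    (Finset.mem_range.mp hb).le x, Finset.sum_add_distrib]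
  simp only [Finset.sum_const, Finset.card_range, nsmul_eq_mul, ← Finset.mul_sum]
  ring

theorem rad_eq_pow (m : ℕ → ℕ) (k : ℕ) (x : G m) :
    rad m k x = Complex.exp (2 * Real.pi * Complex.I / (m k : ℂ)) ^ (x k).val := by
  rw [rad, ← Complex.exp_nat_mul]
  congr 1
  ring

theorem rad_pow_eq_one {m : ℕ → ℕ} (hm : ∀ n, 2 ≤ m n) (k : ℕ) (x : G m) :
    rad m k x ^ m k = 1 := by
  rw [rad_eq_pow, pow_right_comm,
    (Complex.isPrimitiveRoot_exp (m k) (by linarith [hm k])).pow_eq_one, one_pow]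

theorem rad_eq_one_iff {m : ℕ → ℕ} (hm : ∀ n, 2 ≤ m n) (k : ℕ) (x : G m) :
    rad m k x = 1 ↔ x k = 0 := by
  have hk : m k ≠ 0 := by linarith [hm k]
  have : NeZero (m k) := ⟨hk⟩
  rw [rad_eq_pow, (Complex.isPrimitiveRoot_exp (m k) hk).pow_eq_one_iff_dvd,
    ← ZMod.val_eq_zero]
  exact ⟨fun h => Nat.eq_zero_of_dvd_of_lt h (ZMod.val_lt _), fun h => h ▸ dvd_zero _⟩

theorem sum_rad_pow_eq_zero {m : ℕ → ℕ} (hm : ∀ n, 2 ≤ m n) {k : ℕ} {x : G m} (h : x k ≠ 0) :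
    ∑ a ∈ Finset.range (m k), rad m k x ^ a = 0 := by
  rw [geom_sum_eq (mt (rad_eq_one_iff hm k x).mp h), rad_pow_eq_one hm, sub_self, zero_div]

theorem sum_rad_pow_eq_card {m : ℕ → ℕ} (hm : ∀ n, 2 ≤ m n) {k : ℕ} {x : G m} (h : x k = 0) :
    ∑ a ∈ Finset.range (m k), rad m k x ^ a = m k := by
  simp [(rad_eq_one_iff hm k x).mpr h]

theorem sum_sum_rad_pow {m : ℕ → ℕ} (hm : ∀ n, 2 ≤ m n) {k : ℕ} {x : G m} (h : x k ≠ 0) :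
    ∑ a ∈ Finset.range (m k), ∑ i ∈ Finset.range a, rad m k x ^ i =
      m k / (1 - rad m k x) := by
  have hr := mt (rad_eq_one_iff hm k x).mp h
  have hr' : 1 - rad m k x ≠ 0 := sub_ne_zero.mpr (Ne.symm hr)
  rw [eq_div_iff hr', Finset.sum_mul]
  simp only [geom_sum_mul_neg]
  rw [Finset.sum_sub_distrib, sum_rad_pow_eq_zero hm h]
  simp

theorem Dker_Mprod_succ {m : ℕ → ℕ} (hm : ∀ n, 2 ≤ m n) (n : ℕ) (x : G m) :
    Dker m (Mprod m (n + 1)) x =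
      (∑ i ∈ Finset.range (m n), rad m n x ^ i) * Dker m (Mprod m n) x :=
  Dker_mul_Mprod hm le_rfl x

theorem Dker_Mprod_of_mem {m : ℕ → ℕ} (hm : ∀ n, 2 ≤ m n) {n : ℕ} {x : G m}
    (hx : x ∈ cylinder m n 0) : Dker m (Mprod m n) x = Mprod m n := by
  induction n with
  | zero => simp [Mprod, Dker, psi, digit]
  | succ n ih =>
    rw [Dker_Mprod_succ hm, ih fun j hj => hx j (by omega),
      sum_rad_pow_eq_card hm (hx n (by omega)), Mprod, Nat.cast_mul]

theorem Dker_Mprod_eq_zero {m : ℕ → ℕ} (hm : ∀ n, 2 ≤ m n) {t n : ℕ} (htn : t < n) {x : G m}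
    (hx : x t ≠ 0) : Dker m (Mprod m n) x = 0 := by
  induction n, Nat.succ_le_of_lt htn using Nat.le_induction with
  | base => rw [Nat.succ_eq_add_one, Dker_Mprod_succ hm, sum_rad_pow_eq_zero hm hx, zero_mul]
  | succ n hn ih => rw [Dker_Mprod_succ hm, ih hn, mul_zero]

theorem Kker_Mprod_succ_self {m : ℕ → ℕ} (hm : ∀ n, 2 ≤ m n) {t : ℕ} {x : G m}
    (hx : x ∈ cylinder m t 0) (ht : x t ≠ 0) :
    Kker m (Mprod m (t + 1)) x = Mprod m t / (1 - rad m t x) := by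
  have hM : (Mprod m t : ℂ) ≠ 0 := Nat.cast_ne_zero.mpr (Mprod_pos hm t).ne'
  have hmt : (m t : ℂ) ≠ 0 := Nat.cast_ne_zero.mpr (by linarith [hm t])
  rw [Kker, sum_Dker_Mprod_succ hm, Dker_Mprod_of_mem hm hx, sum_sum_rad_pow hm ht,
    sum_rad_pow_eq_zero hm ht, zero_mul, add_zero, Mprod, Nat.cast_mul]
  field_simp

theorem Kker_Mprod_succ {m : ℕ → ℕ} (hm : ∀ n, 2 ≤ m n) {t n : ℕ} (htn : t < n) {x : G m}
    (ht : x t ≠ 0) :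
    Kker m (Mprod m (n + 1)) x = if x n = 0 then Kker m (Mprod m n) x else 0 := by
  have hmn : (m n : ℂ) ≠ 0 := Nat.cast_ne_zero.mpr (by linarith [hm n])
  rw [Kker, sum_Dker_Mprod_succ hm, Dker_Mprod_eq_zero hm htn ht]
  split_ifs with h
  · rw [sum_rad_pow_eq_card hm h, Kker, Mprod, Nat.cast_mul]
    field_simp
    ring
  · rw [sum_rad_pow_eq_zero hm h]
    ring

theorem update_mem_cylinder_zero {m : ℕ → ℕ} {t n : ℕ} {x : G m} :
    Function.update x t 0 ∈ cylinder m n 0 ↔ ∀ j < n, j ≠ t → x j = 0 := by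
  refine forall₂_congr fun j _ => ?_
  by_cases h : j = t
  · subst h
    simp
  · simp [h]

/-- Lemma 3 (Gát): for `n > t` and `x ∈ I_t \ I_{t+1}`, `K_{M_n}(x) = 0` if
`x - x_t e_t ∉ I_n` and `K_{M_n}(x) = M_t/(1 - r_t(x))` if `x - x_t e_t ∈ I_n`. -/
theorem fejer_kernel_Mn
    (m : ℕ → ℕ) (hm : ∀ n, 2 ≤ m n) (hbdd : ∃ B, ∀ n, m n ≤ B)
    (t n : ℕ) (htn : t < n) (x : G m)
    (hx : x ∈ cylinder m t 0) (hx' : x ∉ cylinder m (t + 1) 0) :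
    (Function.update x t 0 ∉ cylinder m n 0 → Kker m (Mprod m n) x = 0) ∧
    (Function.update x t 0 ∈ cylinder m n 0 →
      Kker m (Mprod m n) x = (Mprod m t : ℂ) / (1 - rad m t x)) := by
  have ht : x t ≠ 0 := fun h => hx' fun j hj => by
    rcases Nat.lt_succ_iff_lt_or_eq.mp hj with hj | rfl
    exacts [hx j hj, h]
  simp only [update_mem_cylinder_zero]
  induction n, Nat.succ_le_of_lt htn using Nat.le_induction with
  | base =>
    refine ⟨fun h => absurd (fun j hj hjt => hx j ?_) h, fun _ => Kker_Mprod_succ_self hm hx ht⟩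
    omega
  | succ n hn ih =>
    obtain ⟨ih₀, ih₁⟩ := ih hn
    rw [Kker_Mprod_succ hm hn ht]
    split_ifs with hxn
    · refine ⟨fun h => ih₀ fun h' => h fun j hj hjt => ?_,
        fun h => ih₁ fun j hj hjt => h j (by omega) hjt⟩
      rcases Nat.lt_succ_iff_lt_or_eq.mp hj with hj | rfl
      exacts [h' j hj hjt, hxn]
    · exact ⟨fun _ => rfl, fun h => absurd (h n (by omega) (by omega)) hxn⟩

end Vilenkin
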